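/- The zero vector is a global minimizer of the coop-Lasso objective L if and only if λ ≥ λ_max, where λ_max = max_{1 ≤ k ≤ K} max_{j ∈ G_k} (1/w_k) ‖φ_j((X_{·G_k})ᵀ y)‖ and X_{·G_k} is the submatrix of X consisting of the columns indexed by G_k. -/

import Mathlib

open scoped BigOperators

/-- Euclidean norm of the positive part of `v` restricted to the index set `G`. -/
noncomputable def enormP {α : Type*} (G : Finset α) (v : α → ℝ) : ℝ :=
  Real.sqrt (∑ j ∈ G, (max (v j) 0) ^ 2)

/-- Euclidean norm of the negative part of `v` restricted to the index set `G`. -/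
noncomputable def enormN {α : Type*} (G : Finset α) (v : α → ℝ) : ℝ :=
  Real.sqrt (∑ j ∈ G, (max (-v j) 0) ^ 2)

/-- `‖φ_j(v_G)‖`: the Euclidean norm of `φ_j(v_G)`, where `φ_j(v) = 0` if `v j = 0`,
`φ_j(v) = v⁺` if `v j > 0` and `φ_j(v) = v⁻` if `v j < 0`. -/
noncomputable def phiNorm {α : Type*} (G : Finset α) (v : α → ℝ) (j : α) : ℝ :=
  if 0 < v j then enormP G v else if v j < 0 then enormN G v else 0

/-- The cooperative-Lasso norm associated with groups `G k` and weights `w k`. -/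
noncomputable def coopNorm {p K : ℕ} (G : Fin K → Finset (Fin p)) (w : Fin K → ℝ)
    (v : Fin p → ℝ) : ℝ :=
  ∑ k, w k * (enormP (G k) v + enormN (G k) v)

/-- The coop-Lasso objective `L(β) = (1/2)‖y − Xβ‖² + λ‖β‖_coop`. -/
noncomputable def coopObj {p K n : ℕ} (G : Fin K → Finset (Fin p)) (w : Fin K → ℝ)
    (X : Matrix (Fin n) (Fin p) ℝ) (y : Fin n → ℝ) (lam : ℝ) (β : Fin p → ℝ) : ℝ :=
  (1 / 2) * (∑ i, (y i - Matrix.mulVec X β i) ^ 2) + lam * coopNorm G w β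

lemma enormP_smul {α : Type*} (G : Finset α) (v : α → ℝ) (t : ℝ) (ht : 0 ≤ t) :
    enormP G (fun j => t * v j) = t * enormP G v := by
  unfold enormP
  have h : ∀ j, (max (t * v j) 0) ^ 2 = t ^ 2 * (max (v j) 0) ^ 2 := by
    intro j
    have h2 : max (t * v j) 0 = t * max (v j) 0 := by
      rw [mul_max_of_nonneg _ _ ht, mul_zero]
    rw [h2]; ring
  simp only [h]
  rw [← Finset.mul_sum, Real.sqrt_mul (sq_nonneg t), Real.sqrt_sq ht]

lemma enormN_eq {α : Type*} (G : Finset α) (v : α → ℝ) :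
    enormN G v = enormP G (fun j => - v j) := rfl

lemma enormN_smul {α : Type*} (G : Finset α) (v : α → ℝ) (t : ℝ) (ht : 0 ≤ t) :
    enormN G (fun j => t * v j) = t * enormN G v := by
  rw [enormN_eq, enormN_eq, ← enormP_smul _ _ _ ht]
  simp only [mul_neg]

lemma coopNorm_smul {p K : ℕ} (G : Fin K → Finset (Fin p)) (w : Fin K → ℝ)
    (v : Fin p → ℝ) (t : ℝ) (ht : 0 ≤ t) :
    coopNorm G w (fun j => t * v j) = t * coopNorm G w v := by
  unfold coopNorm
  rw [Finset.mul_sum]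
  refine Finset.sum_congr rfl fun k _ => ?_
  rw [enormP_smul _ _ _ ht, enormN_smul _ _ _ ht]; ring

lemma enormP_nonneg {α : Type*} (G : Finset α) (v : α → ℝ) : 0 ≤ enormP G v :=
  Real.sqrt_nonneg _

lemma enormN_nonneg {α : Type*} (G : Finset α) (v : α → ℝ) : 0 ≤ enormN G v :=
  Real.sqrt_nonneg _

lemma enormP_eq_zero {α : Type*} (G : Finset α) (v : α → ℝ) (h : ∀ j ∈ G, v j ≤ 0) :
    enormP G v = 0 := by
  unfold enormP
  rw [Finset.sum_eq_zero, Real.sqrt_zero]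
  intro j hj
  rw [max_eq_right (h j hj)]; norm_num

lemma coopObj_eq {p K n : ℕ} (G : Fin K → Finset (Fin p)) (w : Fin K → ℝ)
    (X : Matrix (Fin n) (Fin p) ℝ) (y : Fin n → ℝ) (lam : ℝ) (u : Fin p → ℝ) :
    coopObj G w X y lam u = (1 / 2) * (∑ i, y i ^ 2) - ∑ l, (∑ i, X i l * y i) * u l
      + (1 / 2) * (∑ i, (Matrix.mulVec X u i) ^ 2) + lam * coopNorm G w u := by
  have h : ∑ l, (∑ i, X i l * y i) * u l = ∑ i, y i * Matrix.mulVec X u i := by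
    simp only [Matrix.mulVec, dotProduct, Finset.mul_sum, Finset.sum_mul]
    rw [Finset.sum_comm]
    refine Finset.sum_congr rfl fun i _ => Finset.sum_congr rfl fun j _ => by ring
  unfold coopObj
  rw [h]
  have h2 : ∀ i, (y i - Matrix.mulVec X u i) ^ 2
      = y i ^ 2 - 2 * (y i * Matrix.mulVec X u i) + (Matrix.mulVec X u i) ^ 2 := by
    intro i; ring
  simp only [h2, Finset.sum_add_distrib, Finset.sum_sub_distrib, ← Finset.mul_sum]
  ring

lemma coopObj_zero {p K n : ℕ} (G : Fin K → Finset (Fin p)) (w : Fin K → ℝ)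
    (X : Matrix (Fin n) (Fin p) ℝ) (y : Fin n → ℝ) (lam : ℝ) :
    coopObj G w X y lam 0 = (1 / 2) * (∑ i, y i ^ 2) := by
  simp [coopObj, coopNorm, enormP, enormN]

lemma min_iff_dual {p K n : ℕ} (G : Fin K → Finset (Fin p)) (w : Fin K → ℝ)
    (X : Matrix (Fin n) (Fin p) ℝ) (y : Fin n → ℝ) (lam : ℝ) :
    (∀ u : Fin p → ℝ, coopObj G w X y lam 0 ≤ coopObj G w X y lam u) ↔
      ∀ u : Fin p → ℝ, ∑ l, (∑ i, X i l * y i) * u l ≤ lam * coopNorm G w u := by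
  constructor
  · intro h u
    by_contra hc
    push Not at hc
    set A := ∑ l, (∑ i, X i l * y i) * u l with hA
    set C := coopNorm G w u with hC
    set B := (1 / 2) * (∑ i, (Matrix.mulVec X u i) ^ 2) with hB
    have hB0 : 0 ≤ B := by positivity
    have key : ∀ t : ℝ, 0 ≤ t → 0 ≤ - (t * A) + t ^ 2 * B + lam * (t * C) := by
      intro t ht
      have h1 := h (fun j => t * u j)
      rw [coopObj_zero, coopObj_eq, coopNorm_smul _ _ _ _ ht] at h1
      have e1 : ∑ l, (∑ i, X i l * y i) * (t * u l) = t * A := by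
        rw [hA, Finset.mul_sum]
        exact Finset.sum_congr rfl fun l _ => by ring
      have e2 : (1 / 2) * (∑ i, (Matrix.mulVec X (fun j => t * u j) i) ^ 2) = t ^ 2 * B := by
        have : (fun j => t * u j) = t • u := by ext; simp
        rw [this, Matrix.mulVec_smul, hB]
        simp only [Pi.smul_apply, smul_eq_mul, mul_pow, ← Finset.mul_sum]
        ring
      rw [e1, e2] at h1
      linarith
    have hd : 0 < A - lam * C := by linarith
    have ht : 0 < (A - lam * C) / (B + 1) := by positivity
    have h2 := key _ ht.le
    set t := (A - lam * C) / (B + 1) with htd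
    have h3 : t * (B + 1) = A - lam * C := by rw [htd]; field_simp
    nlinarith [mul_pos ht ht]
  · intro h u
    rw [coopObj_zero, coopObj_eq]
    have := h u
    have h2 : 0 ≤ (1 / 2) * (∑ i, (Matrix.mulVec X u i) ^ 2) := by positivity
    linarith

lemma sum_groups {p K : ℕ} (G : Fin K → Finset (Fin p))
    (hcover : ∀ j : Fin p, ∃ k, j ∈ G k)
    (hdisj : ∀ k l : Fin K, k ≠ l → Disjoint (G k) (G l)) (f : Fin p → ℝ) :
    ∑ l, f l = ∑ k, ∑ l ∈ G k, f l := by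
  rw [← Finset.sum_biUnion (fun k _ l _ hkl => hdisj k l hkl)]
  refine Finset.sum_congr ?_ fun _ _ => rfl
  ext j
  simp [hcover j]

lemma group_cs {α : Type*} (G : Finset α) (c u : α → ℝ) :
    ∑ j ∈ G, c j * u j ≤ enormP G c * enormP G u + enormN G c * enormN G u := by
  have h1 := Real.sum_mul_le_sqrt_mul_sqrt G (fun j => max (c j) 0) (fun j => max (u j) 0)
  have h2 := Real.sum_mul_le_sqrt_mul_sqrt G (fun j => max (-c j) 0) (fun j => max (-u j) 0)
  have h3 : ∑ j ∈ G, c j * u j ≤ ∑ j ∈ G, max (c j) 0 * max (u j) 0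
      + ∑ j ∈ G, max (-c j) 0 * max (-u j) 0 := by
    rw [← Finset.sum_add_distrib]
    refine Finset.sum_le_sum fun j _ => ?_
    rcases le_total (c j) 0 with hc | hc <;> rcases le_total (u j) 0 with hu | hu <;>
      simp [hc, hu] <;> nlinarith
  unfold enormP enormN
  linarith

/-- Necessity for the positive part, with a sign `s = ±1`. -/
lemma necessity {p K : ℕ} (G : Fin K → Finset (Fin p))
    (hdisj : ∀ k l : Fin K, k ≠ l → Disjoint (G k) (G l)) (w : Fin K → ℝ)
    (c : Fin p → ℝ) (lam : ℝ)
    (N : (Fin p → ℝ) → ℝ) (hN : ∀ u, N u = coopNorm G w u ∨ N u = coopNorm G w (fun j => - u j))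
    (h : ∀ u : Fin p → ℝ, ∑ l, c l * u l ≤ lam * N u) (k : Fin K) (j : Fin p) (hj : j ∈ G k)
    (hc : 0 < c j) : enormP (G k) c ≤ lam * w k := by
  have hpos : 0 < enormP (G k) c := by
    unfold enormP
    apply Real.sqrt_pos.mpr
    refine Finset.sum_pos' (fun _ _ => sq_nonneg _) ⟨j, hj, ?_⟩
    rw [max_eq_left hc.le]; positivity
  have hneg : ∀ u, coopNorm G w (fun j => - u j) = coopNorm G w u := by
    intro u
    simp only [coopNorm, enormN_eq, neg_neg]
    exact Finset.sum_congr rfl fun k _ => by ring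
  classical
  let u : Fin p → ℝ := fun l => if l ∈ G k then max (c l) 0 else 0
  have h1 := h u
  have hNu : N u = coopNorm G w u := by
    rcases hN u with e | e
    · exact e
    · rw [e, hneg]
  have hu0 : ∀ l, 0 ≤ u l := by
    intro l; simp only [u]; split_ifs <;> simp
  have e1 : ∑ l, c l * u l = enormP (G k) c ^ 2 := by
    unfold enormP
    rw [Real.sq_sqrt (Finset.sum_nonneg fun _ _ => sq_nonneg _)]
    simp only [u, mul_ite, mul_zero, Finset.sum_ite_mem, Finset.univ_inter]
    refine Finset.sum_congr rfl fun l _ => ?_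
    rcases le_total (c l) 0 with hc | hc <;> simp [hc, sq]
  have e2 : coopNorm G w u = w k * enormP (G k) c := by
    unfold coopNorm
    have hn0 : ∀ m, enormN (G m) u = 0 := fun m => by
      rw [enormN_eq]; exact enormP_eq_zero _ _ fun l _ => by linarith [hu0 l]
    rw [Finset.sum_eq_single k]
    · rw [hn0, add_zero]
      congr 1
      unfold enormP
      congr 1
      refine Finset.sum_congr rfl fun l hl => ?_
      simp [u, hl]
    · intro m _ hm
      rw [hn0, enormP_eq_zero, add_zero, mul_zero]
      intro l hl
      have : l ∉ G k := Finset.disjoint_left.mp (hdisj m k hm) hl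
      simp [u, this]
    · simp
  rw [hNu, e1, e2] at h1
  nlinarith

/-- the zero vector is a global minimizer of the coop-Lasso objective iff
`λ ≥ λ_max`, where `λ_max = max_k max_{j ∈ G_k} (1/w_k)‖φ_j((X_{·G_k})ᵀ y)‖`. -/
theorem coopLasso_zero_is_min_iff (p K n : ℕ) (hp : 1 ≤ p) (hn : 1 ≤ n)
    (G : Fin K → Finset (Fin p))
    (hcover : ∀ j : Fin p, ∃ k, j ∈ G k)
    (hdisj : ∀ k l : Fin K, k ≠ l → Disjoint (G k) (G l))
    (w : Fin K → ℝ) (hw : ∀ k, 0 < w k)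
    (X : Matrix (Fin n) (Fin p) ℝ) (y : Fin n → ℝ)
    (lam : ℝ) (hlam : 0 ≤ lam)
    (lmax : ℝ)
    (hlmax : IsGreatest
      {r : ℝ | ∃ k, ∃ j ∈ G k,
        r = (1 / w k) * phiNorm (G k) (fun l => ∑ i, X i l * y i) j} lmax) :
    (∀ u : Fin p → ℝ, coopObj G w X y lam 0 ≤ coopObj G w X y lam u) ↔ lmax ≤ lam := by
  rw [min_iff_dual]
  set c : Fin p → ℝ := fun l => ∑ i, X i l * y i with hc
  constructor
  · intro h
    obtain ⟨k, j, hj, hr⟩ := hlmax.1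
    have hwk := hw k
    suffices hs : phiNorm (G k) c j ≤ lam * w k by
      rw [hr, one_div, inv_mul_le_iff₀ hwk]; linarith
    unfold phiNorm
    split_ifs with h1 h2
    · exact necessity G hdisj w c lam _ (fun u => Or.inl rfl) h k j hj h1
    · rw [enormN_eq]
      refine necessity G hdisj w (fun l => - c l) lam
        (fun u => coopNorm G w (fun j => - u j)) (fun u => Or.inr rfl) (fun u => ?_) k j hj
        (by linarith)
      have := h (fun j => - u j)
      calc ∑ l, -c l * u l = ∑ l, c l * (- u l) := Finset.sum_congr rfl fun l _ => by ring
        _ ≤ _ := this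
    · positivity
  · intro hle u
    have hb : ∀ k, ∀ j ∈ G k, phiNorm (G k) c j ≤ lam * w k := by
      intro k j hj
      have h1 := (hlmax.2 ⟨k, j, hj, rfl⟩).trans hle
      rw [one_div, inv_mul_le_iff₀ (hw k)] at h1
      linarith
    have hP : ∀ k, enormP (G k) c ≤ lam * w k := by
      intro k
      by_cases hex : ∃ j ∈ G k, 0 < c j
      · obtain ⟨j, hj, hcj⟩ := hex
        have := hb k j hj
        rwa [phiNorm, if_pos hcj] at this
      · push Not at hex
        rw [enormP_eq_zero _ _ hex]
        exact mul_nonneg hlam (hw k).le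
    have hNn : ∀ k, enormN (G k) c ≤ lam * w k := by
      intro k
      by_cases hex : ∃ j ∈ G k, c j < 0
      · obtain ⟨j, hj, hcj⟩ := hex
        have := hb k j hj
        rwa [phiNorm, if_neg hcj.not_gt, if_pos hcj] at this
      · push Not at hex
        rw [enormN_eq, enormP_eq_zero _ _ (fun j hj => by linarith [hex j hj])]
        exact mul_nonneg hlam (hw k).le
    rw [sum_groups G hcover hdisj]
    unfold coopNorm
    rw [Finset.mul_sum]
    refine Finset.sum_le_sum fun k _ => ?_
    have h1 := group_cs (G k) c u
    have h2 := mul_le_mul_of_nonneg_right (hP k) (enormP_nonneg (G k) u)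
    have h3 := mul_le_mul_of_nonneg_right (hNn k) (enormN_nonneg (G k) u)
    change ∑ l ∈ G k, c l * u l ≤ _
    linarith
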